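/- (Lemma 2, item ii.) Fix α ∈ {0,1}. Consider the system of Lemma 2: differentiable η_i : [0,∞) → ℝ^N with η̇_i = Ψ_i(t) for i ∈ L, and η̇_i = −k_{η_i}(η_i − δ_i) + Φ_{i,1}(t) for i ∈ F with k_{η_i} > 0, where δ_i = α·ζ_{i,1} + (1−α)·ε_i, ε_i(t) = (1/κ_i)·Σ_{j=1}^n a_{ij}·η_j(d_{ij}(t)), and ζ_{i,1},…,ζ_{i,σ_i} : [0,∞) → ℝ^N are differentiable with ζ̇_{i,ℓ} = −h_{i,ℓ}(ζ_{i,ℓ} − ζ_{i,ℓ+1}) + Φ_{i,2}^{(ℓ)}(t) for ℓ = 1,…,σ_i−1 and ζ̇_{i,σ_i} = −h_{i,σ_i}(ζ_{i,σ_i} − ε_i) + Φ_{i,2}^{(σ_i)}(t), all h_{i,ℓ} > 0. Suppose Assumptions 1 and 2 hold, all perturbations Φ_{i,1}, Φ_{i,2}^{(ℓ)} (i ∈ F) and Ψ_i (i ∈ L) are uniformly bounded, and moreover Φ_{i,1}(t) → 0, Φ_{i,2}^{(ℓ)}(t) → 0 and Ψ_i(t) → 0 as t → ∞. Then ζ̇_{i,ℓ}(t)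 → 0 and η̇_i(t) → 0 as t → ∞ for all followers i ∈ F, and η_F(t) + (𝓛₁⁻¹𝓛₂ ⊗ I_N)η_L(t) → 0 as t → ∞, where η_F and η_L are the column stacks of the followers' and leaders' states. -/

import Mathlib

open Filter Matrix

noncomputable section

/-- In-degree of follower `i`: `κ_i = ∑_j a_{ij}`. Agents are `Fin m ⊕ Fin l`,
followers `Sum.inl`, leaders `Sum.inr`. -/
def kappa {m l : ℕ} (a : Fin m ⊕ Fin l → Fin m ⊕ Fin l → ℝ) (i : Fin m) : ℝ :=
  ∑ k, a (Sum.inl i) k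

/-- The follower-follower block `𝓛₁ = D₁ − A₁` of the Laplacian. -/
def lapOne {m l : ℕ} (a : Fin m ⊕ Fin l → Fin m ⊕ Fin l → ℝ) :
    Matrix (Fin m) (Fin m) ℝ :=
  Matrix.diagonal (kappa a) - Matrix.of (fun i j => a (Sum.inl i) (Sum.inl j))

/-- The follower-leader block `𝓛₂ = −A₂` of the Laplacian. -/
def lapTwo {m l : ℕ} (a : Fin m ⊕ Fin l → Fin m ⊕ Fin l → ℝ) :
    Matrix (Fin m) (Fin l) ℝ :=
  Matrix.of (fun i j => -(a (Sum.inl i) (Sum.inr j)))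

/-- Assumption 1: every follower is reachable from some leader by a directed path. -/
def Assumption1 {m l : ℕ} (a : Fin m ⊕ Fin l → Fin m ⊕ Fin l → ℝ) : Prop :=
  ∀ i : Fin m, ∃ j : Fin l,
    Relation.TransGen (fun x y => 0 < a y x) (Sum.inr j) (Sum.inl i)

/-- The delayed neighborhood average `ε_i(t) = κ_i⁻¹ ∑_j a_{ij} η_j(d_{ij}(t))`. -/
def epsAvg {m l N : ℕ} (a : Fin m ⊕ Fin l → Fin m ⊕ Fin l → ℝ)
    (d : Fin m → Fin m ⊕ Fin l → ℝ → ℝ)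
    (η : Fin m ⊕ Fin l → ℝ → EuclideanSpace ℝ (Fin N)) (i : Fin m) (t : ℝ) :
    EuclideanSpace ℝ (Fin N) :=
  (kappa a i)⁻¹ • ∑ j, a (Sum.inl i) j • η j (d i j t)

/-- The containment error: `i`-th block of `η_F + (𝓛₁⁻¹𝓛₂ ⊗ I_N) η_L`. -/
def centErr {m l N : ℕ} (a : Fin m ⊕ Fin l → Fin m ⊕ Fin l → ℝ)
    (η : Fin m ⊕ Fin l → ℝ → EuclideanSpace ℝ (Fin N)) (i : Fin m) (t : ℝ) :
    EuclideanSpace ℝ (Fin N) :=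
  η (Sum.inl i) t + ∑ j, ((lapOne a)⁻¹ * lapTwo a) i j • η (Sum.inr j) t

section DelayedContraction

variable {E : Type*} [NormedAddCommGroup E]

/-- The limit superior of `‖f t‖` as `t → ∞` is at most `B`. -/
def EventuallyNormLe (f : ℝ → E) (B : ℝ) : Prop :=
  ∀ ε > 0, ∀ᶠ t in atTop, ‖f t‖ ≤ B + ε

theorem EventuallyNormLe.tendsto_zero {f : ℝ → E} (hf : EventuallyNormLe f 0) :
    Tendsto f atTop (nhds 0) := by
  rw [Metric.tendsto_nhds]
  intro ε hε
  filter_upwards [hf (ε / 2) (half_pos hε)] with t ht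
  rw [dist_zero_right]
  linarith

theorem eventuallyNormLe_zero_of_tendsto {f : ℝ → E} (hf : Tendsto f atTop (nhds 0)) :
    EventuallyNormLe f 0 := by
  intro ε hε
  filter_upwards [Metric.tendsto_nhds.1 hf ε hε] with t ht
  rw [dist_zero_right] at ht
  linarith

/-- The response `f` to the input `g` has unit gain: uniform bounds on `g` are inherited by `f`
up to a constant, and asymptotic bounds on `g` are inherited exactly. -/
structure HasUnitGain (g f : ℝ → E) : Prop where
  bound : ∃ C, 0 ≤ C ∧ ∀ T B, 0 ≤ B → (∀ t ∈ Set.Icc 0 T, ‖g t‖ ≤ B) →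
    ∀ t ∈ Set.Icc 0 T, ‖f t‖ ≤ C + B
  limit : ∀ B, 0 ≤ B → EventuallyNormLe g B → EventuallyNormLe f B

theorem HasUnitGain.trans {f g u : ℝ → E} (h₁ : HasUnitGain f g) (h₂ : HasUnitGain g u) :
    HasUnitGain f u := by
  refine ⟨?_, fun B hB hf => h₂.limit B hB (h₁.limit B hB hf)⟩
  obtain ⟨C, hC, H⟩ := h₁.bound
  obtain ⟨C', hC', H'⟩ := h₂.bound
  refine ⟨C' + C, by positivity, fun T B hB hf t ht => ?_⟩
  have := H' T (C + B) (by positivity) (H T B hB hf) t ht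
  linarith

/-- A family of unit-gain responses coupled through boundedly delayed inputs, contracting in a
weighted supremum norm up to bounded vanishing errors, converges to zero. -/
theorem tendsto_zero_of_delayed_contraction {ι : Type*} [Fintype ι]
    {x e r : ι → ℝ → E} {w : ι → ι → ℝ} {d : ι → ι → ℝ → ℝ} {v : ι → ℝ} {ρ T : ℝ}
    (hgain : ∀ i, HasUnitGain (e i) (x i))
    (hx : ∀ i, ContinuousOn (x i) (Set.Ici 0))
    (hle : ∀ i t, 0 ≤ t → ‖e i t‖ ≤ ∑ j, w i j * ‖x j (d i j t)‖ + ‖r i t‖)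
    (hr : ∀ i, ∃ C, ∀ t, 0 ≤ t → ‖r i t‖ ≤ C)
    (hr0 : ∀ i, Tendsto (r i) atTop (nhds 0))
    (hw : ∀ i j, 0 ≤ w i j)
    (hd : ∀ i j, 0 < w i j → ∀ t, 0 ≤ t → 0 ≤ d i j t ∧ d i j t ≤ t)
    (hdT : ∀ i j, 0 < w i j → ∀ t, 0 ≤ t → t - T ≤ d i j t)
    (hv : ∀ i, 0 < v i) (hρ0 : 0 ≤ ρ) (hρ1 : ρ < 1)
    (hwv : ∀ i, ∑ j, w i j * v j ≤ ρ * v i) (i : ι) :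
    Tendsto (x i) atTop (nhds 0) := by
  have hsum : ∀ (i : ι) (t M : ℝ), 0 ≤ M →
      (∀ j, 0 < w i j → ‖x j (d i j t)‖ ≤ M * v j) →
      ∑ j, w i j * ‖x j (d i j t)‖ ≤ ρ * v i * M := by
    intro i t M hM h
    calc ∑ j, w i j * ‖x j (d i j t)‖ ≤ ∑ j, M * (w i j * v j) := by
          refine Finset.sum_le_sum fun j _ => ?_
          rcases (hw i j).eq_or_lt with h0 | h0
          · simp [← h0]
          · calc _ ≤ w i j * (M * v j) := mul_le_mul_of_nonneg_left (h j h0) h0.le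
              _ = _ := by ring
      _ = M * ∑ j, w i j * v j := by rw [Finset.mul_sum]
      _ ≤ M * (ρ * v i) := mul_le_mul_of_nonneg_left (hwv i) hM
      _ = _ := by ring
  choose C hC0 hC using fun i => (hgain i).bound
  choose R hR using hr
  have hR0 : ∀ i, 0 ≤ R i := fun i => (norm_nonneg _).trans (hR i 0 le_rfl)
  set K := ∑ i, (C i + R i) / v i with hK
  have hterm : ∀ i, 0 ≤ (C i + R i) / v i := fun i =>
    div_nonneg (add_nonneg (hC0 i) (hR0 i)) (hv i).le
  have hK0 : 0 ≤ K := Finset.sum_nonneg fun i _ => hterm i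
  have hKi : ∀ i, C i + R i ≤ K * v i := fun i =>
    (div_le_iff₀ (hv i)).1 (Finset.single_le_sum (fun i _ => hterm i) (Finset.mem_univ i))
  have h1ρ : 0 < 1 - ρ := by linarith
  have hbdd : ∀ i t, 0 ≤ t → ‖x i t‖ ≤ K / (1 - ρ) * v i := by
    intro i t ht
    have hcpt : ∀ j, ∃ B, ∀ u ∈ Set.Icc 0 t, ‖x j u‖ ≤ B := fun j =>
      isCompact_Icc.exists_bound_of_continuousOn ((hx j).mono Set.Icc_subset_Ici_self)
    choose B hB using hcpt
    have hB0 : ∀ j, 0 ≤ B j / v j := fun j =>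
      div_nonneg ((norm_nonneg _).trans (hB j 0 ⟨le_rfl, ht⟩)) (hv j).le
    have hind : ∀ n : ℕ, ∀ j, ∀ u ∈ Set.Icc 0 t,
        ‖x j u‖ ≤ (K / (1 - ρ) + ρ ^ n * ∑ j, B j / v j) * v j := by
      intro n
      induction n with
      | zero =>
        intro j u hu
        have h1 : B j / v j ≤ ∑ j, B j / v j :=
          Finset.single_le_sum (fun i _ => hB0 i) (Finset.mem_univ j)
        have h2 : 0 ≤ K / (1 - ρ) * v j := mul_nonneg (div_nonneg hK0 h1ρ.le) (hv j).le
        rw [div_le_iff₀ (hv j)] at h1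
        rw [pow_zero, one_mul, add_mul]
        linarith [hB j u hu]
      | succ n ih =>
        intro j u hu
        set M := K / (1 - ρ) + ρ ^ n * ∑ j, B j / v j with hM
        have hM0 : 0 ≤ M := add_nonneg (div_nonneg hK0 h1ρ.le)
          (mul_nonneg (pow_nonneg hρ0 n) (Finset.sum_nonneg fun j _ => hB0 j))
        have h1 := hC j t (ρ * v j * M + R j)
          (add_nonneg (mul_nonneg (mul_nonneg hρ0 (hv j).le) hM0) (hR0 j))
          (fun s hs => (hle j s hs.1).trans (add_le_add
            (hsum j s M hM0 fun k hk => ih k _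
              ⟨(hd j k hk s hs.1).1, (hd j k hk s hs.1).2.trans hs.2⟩) (hR j s hs.1))) u hu
        have h2 : (K / (1 - ρ) + ρ ^ (n + 1) * ∑ j, B j / v j) = K + ρ * M := by
          rw [hM, pow_succ]
          field_simp
          ring
        rw [h2]
        linarith [hKi j]
    have hlim : Tendsto (fun n : ℕ => (K / (1 - ρ) + ρ ^ n * ∑ j, B j / v j) * v i) atTop
        (nhds ((K / (1 - ρ) + 0 * ∑ j, B j / v j) * v i)) :=
      (((tendsto_pow_atTop_nhds_zero_of_lt_one hρ0 hρ1).mul_const _).const_add _).mul_const _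
    have := ge_of_tendsto' hlim fun n => hind n i t ⟨ht, le_rfl⟩
    simpa using this
  set θ := (1 + ρ) / 2 with hθ
  have hθ0 : 0 < θ := by rw [hθ]; linarith
  have hθ1 : θ < 1 := by rw [hθ]; linarith
  have hθρ : 0 < θ - ρ := by rw [hθ]; linarith
  set M₀ := K / (1 - ρ) + 1 with hM₀
  have hM₀pos : 0 < M₀ := add_pos_of_nonneg_of_pos (div_nonneg hK0 h1ρ.le) one_pos
  have hdecay : ∀ n : ℕ, ∀ᶠ t in atTop, ∀ i, ‖x i t‖ ≤ θ ^ n * M₀ * v i := by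
    intro n
    induction n with
    | zero =>
      filter_upwards [eventually_ge_atTop 0] with t ht i
      refine (hbdd i t ht).trans (mul_le_mul_of_nonneg_right ?_ (hv i).le)
      rw [pow_zero, one_mul]
      linarith
    | succ n ih =>
      rw [eventually_all]
      intro i
      set M := θ ^ n * M₀ with hM
      have hM0 : 0 < M := by positivity
      have hei : EventuallyNormLe (e i) (ρ * v i * M) := by
        intro ε hε
        obtain ⟨s, hs⟩ := eventually_atTop.1 ih
        filter_upwards [eventually_ge_atTop 0, eventually_ge_atTop (s + T),
          eventuallyNormLe_zero_of_tendsto (hr0 i) ε hε] with t ht hst hrt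
        refine (hle i t ht).trans (add_le_add (hsum i t M hM0.le fun j hj => ?_)
          (by simpa using hrt))
        exact hs _ (by linarith [hdT i j hj t ht]) j
      have hpos : 0 < (θ - ρ) * v i * M := mul_pos (mul_pos hθρ (hv i)) hM0
      filter_upwards [(hgain i).limit _ (mul_nonneg (mul_nonneg hρ0 (hv i).le) hM0.le) hei _ hpos]
        with t ht
      refine ht.trans (le_of_eq ?_)
      rw [hM, pow_succ]
      ring
  apply EventuallyNormLe.tendsto_zero
  intro ε hε
  have hlim : Tendsto (fun n : ℕ => θ ^ n * M₀ * v i) atTop (nhds (0 * M₀ * v i)) :=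
    ((tendsto_pow_atTop_nhds_zero_of_lt_one hθ0.le hθ1).mul_const _).mul_const _
  rw [zero_mul, zero_mul] at hlim
  obtain ⟨n, hn⟩ := (hlim.eventually (gt_mem_nhds hε)).exists
  filter_upwards [hdecay n] with t ht
  linarith [ht i]

variable [NormedSpace ℝ E]

/-- Explicit bound for the first order lag `f' = -k (f - g) + p`. -/
theorem norm_le_of_first_order_lag {f g p : ℝ → E} {k s T B P : ℝ} (hk : 0 < k)
    (hf : ∀ t ∈ Set.Icc s T, HasDerivAt f (-k • (f t - g t) + p t) t)
    (hB : 0 ≤ B) (hP : 0 ≤ P)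
    (hg : ∀ t ∈ Set.Icc s T, ‖g t‖ ≤ B) (hp : ∀ t ∈ Set.Icc s T, ‖p t‖ ≤ P) :
    ∀ t ∈ Set.Icc s T, ‖f t‖ ≤ Real.exp (-(k * (t - s))) * ‖f s‖ + (B + P / k) := by
  have hexp : ∀ t, HasDerivAt (fun t => Real.exp (k * (t - s)))
      (Real.exp (k * (t - s)) * k) t := by
    intro t
    have h1 : HasDerivAt (fun t => k * (t - s)) k t := by
      simpa using ((hasDerivAt_id t).sub_const s).const_mul k
    exact h1.exp
  have hF : ∀ t ∈ Set.Icc s T, HasDerivAt (fun t => Real.exp (k * (t - s)) • f t)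
      (Real.exp (k * (t - s)) • (k • g t + p t)) t := by
    intro t ht
    refine ((hexp t).smul (hf t ht)).congr_deriv ?_
    module
  intro t ht
  have key := image_norm_le_of_norm_deriv_right_le_deriv_boundary
    (f := fun t => Real.exp (k * (t - s)) • f t)
    (f' := fun t => Real.exp (k * (t - s)) • (k • g t + p t))
    (B := fun t => ‖f s‖ + (B + P / k) * (Real.exp (k * (t - s)) - 1))
    (B' := fun t => (B + P / k) * (Real.exp (k * (t - s)) * k))
    (a := s) (b := T)
    (fun t ht => (hF t ht).continuousAt.continuousWithinAt)
    (fun t ht => (hF t (Set.Ico_subset_Icc_self ht)).hasDerivWithinAt)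
    (by simp)
    (fun t => (((hexp t).sub_const 1).const_mul _).const_add _)
    (by
      intro t ht
      have ht' := Set.Ico_subset_Icc_self ht
      rw [norm_smul, Real.norm_eq_abs, abs_of_pos (Real.exp_pos _)]
      have h1 : ‖k • g t + p t‖ ≤ k * B + P := by
        refine (norm_add_le _ _).trans (add_le_add ?_ (hp t ht'))
        rw [norm_smul, Real.norm_eq_abs, abs_of_pos hk]
        exact mul_le_mul_of_nonneg_left (hg t ht') hk.le
      calc _ ≤ Real.exp (k * (t - s)) * (k * B + P) := by gcongr
        _ = _ := by field_simp)
    ht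
  simp only [norm_smul, Real.norm_eq_abs, abs_of_pos (Real.exp_pos _)] at key
  have hpos := Real.exp_pos (k * (t - s))
  have hBP : 0 ≤ B + P / k := by positivity
  rw [Real.exp_neg]
  refine le_of_mul_le_mul_left ?_ hpos
  rw [mul_add, ← mul_assoc, mul_inv_cancel₀ hpos.ne', one_mul]
  linarith

/-- A first order lag with a bounded, vanishing perturbation has unit gain. -/
theorem HasUnitGain.of_first_order_lag {f g p : ℝ → E} {k : ℝ} (hk : 0 < k)
    (hf : ∀ t, 0 ≤ t → HasDerivAt f (-k • (f t - g t) + p t) t)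
    (hp : ∃ C, ∀ t, 0 ≤ t → ‖p t‖ ≤ C) (hp0 : Tendsto p atTop (nhds 0)) :
    HasUnitGain g f := by
  constructor
  · obtain ⟨P, hP⟩ := hp
    have hP0 : 0 ≤ P := (norm_nonneg _).trans (hP 0 le_rfl)
    refine ⟨‖f 0‖ + P / k, by positivity, fun T B hB hg t ht => ?_⟩
    have h1 := norm_le_of_first_order_lag (s := 0) hk (fun t ht => hf t ht.1) hB hP0 hg
      (fun t ht => hP t ht.1) t ht
    have h2 : Real.exp (-(k * (t - 0))) ≤ 1 := by
      rw [Real.exp_le_one_iff, sub_zero]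
      have := mul_nonneg hk.le ht.1
      linarith
    have h3 := mul_le_mul_of_nonneg_right h2 (norm_nonneg (f 0))
    linarith
  · intro B hB hg ε hε
    have hε3 : 0 < ε / 3 := by positivity
    have hp1 := eventuallyNormLe_zero_of_tendsto hp0 (k * (ε / 3)) (by positivity)
    obtain ⟨s, hs⟩ := eventually_atTop.1 ((hg (ε / 3) hε3).and (hp1.and (eventually_ge_atTop 0)))
    have hs0 : 0 ≤ s := (hs s le_rfl).2.2
    have hlim : Tendsto (fun t => Real.exp (-(k * (t - s))) * ‖f s‖) atTop (nhds 0) := by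
      rw [← zero_mul ‖f s‖]
      refine Tendsto.mul_const _ (Real.tendsto_exp_neg_atTop_nhds_zero.comp ?_)
      exact (tendsto_atTop_add_const_right _ (-s) tendsto_id).const_mul_atTop hk
    filter_upwards [eventually_ge_atTop s, hlim.eventually (gt_mem_nhds hε3)] with t hst ht
    have h1 := norm_le_of_first_order_lag (s := s) (T := t) (P := k * (ε / 3)) hk
      (fun u hu => hf u (hs0.trans hu.1)) (by positivity : 0 ≤ B + ε / 3)
      (by positivity) (fun u hu => (hs u hu.1).1)
      (fun u hu => by simpa using (hs u hu.1).2.1) t ⟨hst, le_rfl⟩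
    rw [mul_div_cancel_left₀ _ hk.ne'] at h1
    linarith

/-- A slowly varying function changes little over bounded delays. -/
theorem slow_variation {c c' : ℝ → E} {d : ℝ → ℝ} {T : ℝ} (hT : 0 ≤ T)
    (hc : ∀ t, 0 ≤ t → HasDerivAt c (c' t) t)
    (hb : ∃ C, ∀ t, 0 ≤ t → ‖c' t‖ ≤ C) (hc0 : Tendsto c' atTop (nhds 0))
    (hd : ∀ t, 0 ≤ t → 0 ≤ d t ∧ d t ≤ t) (hdT : ∀ t, 0 ≤ t → t - T ≤ d t) :
    (∃ C, ∀ t, 0 ≤ t → ‖c (d t) - c t‖ ≤ C) ∧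
      Tendsto (fun t => c (d t) - c t) atTop (nhds 0) := by
  have key : ∀ t C, 0 ≤ t → (∀ u ∈ Set.Icc (d t) t, ‖c' u‖ ≤ C) →
      ‖c (d t) - c t‖ ≤ C * T := by
    intro t C ht hC
    have hC0 : 0 ≤ C := (norm_nonneg _).trans (hC t ⟨(hd t ht).2, le_rfl⟩)
    have := (convex_Icc (d t) t).norm_image_sub_le_of_norm_hasDerivWithin_le
      (fun u hu => (hc u ((hd t ht).1.trans hu.1)).hasDerivWithinAt) hC
      (Set.right_mem_Icc.2 (hd t ht).2) (Set.left_mem_Icc.2 (hd t ht).2)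
    refine this.trans (mul_le_mul_of_nonneg_left ?_ hC0)
    rw [Real.norm_eq_abs, abs_le]
    constructor <;> linarith [(hd t ht).2, hdT t ht]
  constructor
  · obtain ⟨C, hC⟩ := hb
    exact ⟨C * T, fun t ht => key t C ht fun u hu => hC u ((hd t ht).1.trans hu.1)⟩
  · apply EventuallyNormLe.tendsto_zero
    intro ε hε
    have hT1 : 0 < T + 1 := by linarith
    obtain ⟨s, hs⟩ := eventually_atTop.1
      (eventuallyNormLe_zero_of_tendsto hc0 (ε / (T + 1)) (by positivity))
    filter_upwards [eventually_ge_atTop 0, eventually_ge_atTop (s + T)] with t ht hst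
    have h1 := key t (0 + ε / (T + 1)) ht fun u hu => hs u (by linarith [hu.1, hdT t ht])
    refine h1.trans ?_
    rw [zero_add, zero_add, div_mul_eq_mul_div, div_le_iff₀ hT1]
    nlinarith

/-- Linear combinations preserve being bounded on `[0, ∞)` and vanishing at infinity. -/
theorem bounded_vanishing_sum {ι : Type*} [Fintype ι] {f : ι → ℝ → E} (b : ι → ℝ)
    (hb : ∀ i, ∃ C, ∀ t, 0 ≤ t → ‖f i t‖ ≤ C) (h0 : ∀ i, Tendsto (f i) atTop (nhds 0)) :
    (∃ C, ∀ t, 0 ≤ t → ‖∑ i, b i • f i t‖ ≤ C) ∧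
      Tendsto (fun t => ∑ i, b i • f i t) atTop (nhds 0) := by
  constructor
  · choose C hC using hb
    refine ⟨∑ i, ‖b i‖ * C i, fun t ht => norm_sum_le_of_le _ fun i _ => ?_⟩
    rw [norm_smul]
    exact mul_le_mul_of_nonneg_left (hC i t ht) (norm_nonneg _)
  · simpa using tendsto_finsetSum Finset.univ fun i _ => (h0 i).const_smul (b i)

end DelayedContraction

section Laplacian

variable {m l : ℕ} {a : Fin m ⊕ Fin l → Fin m ⊕ Fin l → ℝ}

theorem kappa_pos (hann : ∀ k k', 0 ≤ a k k') (hA1 : Assumption1 a) (i : Fin m) :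
    0 < kappa a i := by
  obtain ⟨j, hj⟩ := hA1 i
  obtain ⟨k, -, hk⟩ := Relation.TransGen.tail'_iff.1 hj
  exact Finset.sum_pos' (fun k _ => hann _ k) ⟨k, Finset.mem_univ k, hk⟩

theorem lapOne_mulVec (u : Fin m → ℝ) (i : Fin m) :
    (lapOne a *ᵥ u) i = kappa a i * u i - ∑ j, a (Sum.inl i) (Sum.inl j) * u j := by
  rw [lapOne, Matrix.sub_mulVec, Pi.sub_apply, Matrix.mulVec_diagonal]
  rfl

/-- Minimum principle for the follower block of the Laplacian. -/
theorem nonneg_of_lapOne_mulVec_nonneg (hann : ∀ k k', 0 ≤ a k k') (hA1 : Assumption1 a)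
    {u : Fin m → ℝ} (hu : ∀ i, 0 ≤ (lapOne a *ᵥ u) i) (i : Fin m) : 0 ≤ u i := by
  by_contra! hi
  obtain ⟨i₀, -, hmin⟩ := Finset.exists_min_image Finset.univ u ⟨i, Finset.mem_univ i⟩
  have hneg : u i₀ < 0 := (hmin i (Finset.mem_univ i)).trans_lt hi
  set U : Fin m ⊕ Fin l → ℝ := Sum.elim u 0 with hU
  have hUmin : ∀ k, u i₀ ≤ U k := by
    rintro (k | k)
    · exact hmin k (Finset.mem_univ k)
    · exact hneg.le
  have hstep : ∀ x y, 0 < a y x → U y = u i₀ → U x = u i₀ := by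
    rintro x (y | y) hxy hy
    · have hsum : ∑ k, a (Sum.inl y) k * (U k - u i₀) ≤ 0 := by
        have h1 := hu y
        rw [lapOne_mulVec] at h1
        simp only [hU, Sum.elim_inl] at hy
        have h2 : ∑ k, a (Sum.inl y) k * (U k - u i₀) =
            ∑ j, a (Sum.inl y) (Sum.inl j) * u j - kappa a y * u y := by
          simp only [mul_sub, Finset.sum_sub_distrib, ← Finset.sum_mul, hy, kappa]
          congr 1
          simp [hU, Fintype.sum_sum_type]
        linarith
      have hnn : ∀ k ∈ Finset.univ, 0 ≤ a (Sum.inl y) k * (U k - u i₀) := fun k _ =>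
        mul_nonneg (hann _ k) (sub_nonneg.2 (hUmin k))
      have h0 := (Finset.sum_eq_zero_iff_of_nonneg hnn).1
        (le_antisymm hsum (Finset.sum_nonneg hnn)) x (Finset.mem_univ x)
      rcases mul_eq_zero.1 h0 with h | h
      · exact absurd h hxy.ne'
      · linarith
    · simp only [hU, Sum.elim_inr, Pi.zero_apply] at hy
      exact absurd hy hneg.ne'
  obtain ⟨j, hj⟩ := hA1 i₀
  have hback : ∀ x y, Relation.TransGen (fun x y => 0 < a y x) x y →
      U y = u i₀ → U x = u i₀ := by
    intro x y hxy
    induction hxy with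
    | single h => exact hstep _ _ h
    | tail _ h ih => exact fun hy => ih (hstep _ _ h hy)
  have := hback _ _ hj rfl
  simp only [hU, Sum.elim_inr, Pi.zero_apply] at this
  exact hneg.ne' this

theorem isUnit_det_lapOne (hann : ∀ k k', 0 ≤ a k k') (hA1 : Assumption1 a) :
    IsUnit (lapOne a).det := by
  rw [← Matrix.isUnit_iff_isUnit_det, ← Matrix.mulVec_injective_iff_isUnit]
  intro u u' huu
  have hle : ∀ {u u' : Fin m → ℝ}, lapOne a *ᵥ u = lapOne a *ᵥ u' → ∀ i, u' i ≤ u i := by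
    intro u u' h i
    have := nonneg_of_lapOne_mulVec_nonneg hann hA1 (u := u - u')
      (fun i => by rw [Matrix.mulVec_sub, h, sub_self, Pi.zero_apply]) i
    simpa using this
  exact funext fun i => le_antisymm (hle huu.symm i) (hle huu i)

/-- A positive weight in which the normalized follower adjacency matrix is a contraction. -/
theorem exists_contraction_weight (hann : ∀ k k', 0 ≤ a k k') (hA1 : Assumption1 a) :
    ∃ (v : Fin m → ℝ) (ρ : ℝ), (∀ i, 0 < v i) ∧ 0 ≤ ρ ∧ ρ < 1 ∧
      ∀ i, ∑ j, (kappa a i)⁻¹ * a (Sum.inl i) (Sum.inl j) * v j ≤ ρ * v i := by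
  have hκ := kappa_pos hann hA1
  set v : Fin m → ℝ := (lapOne a)⁻¹ *ᵥ (fun _ => 1) with hv
  have hLv : lapOne a *ᵥ v = fun _ => 1 := by
    rw [hv, Matrix.mulVec_mulVec, Matrix.mul_nonsing_inv _ (isUnit_det_lapOne hann hA1),
      Matrix.one_mulVec]
  have hv0 := nonneg_of_lapOne_mulVec_nonneg hann hA1 (u := v)
    (fun i => by rw [hLv]; exact zero_le_one)
  have heq : ∀ i, ∑ j, a (Sum.inl i) (Sum.inl j) * v j = kappa a i * v i - 1 := by
    intro i
    have := congrFun hLv i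
    rw [lapOne_mulVec] at this
    linarith
  have hvpos : ∀ i, 0 < v i := by
    intro i
    have h1 : 0 ≤ ∑ j, a (Sum.inl i) (Sum.inl j) * v j :=
      Finset.sum_nonneg fun j _ => mul_nonneg (hann _ _) (hv0 j)
    rw [heq] at h1
    exact pos_of_mul_pos_right (by linarith : 0 < kappa a i * v i) (hκ i).le
  set S := 1 + ∑ i, kappa a i * v i with hS
  have hnn : ∀ i ∈ Finset.univ, 0 ≤ kappa a i * v i := fun i _ =>
    (mul_pos (hκ i) (hvpos i)).le
  have hS1 : 1 ≤ S := le_add_of_nonneg_right (Finset.sum_nonneg hnn)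
  have hSpos : 0 < S := by linarith
  refine ⟨v, 1 - 1 / S, hvpos, ?_, ?_, fun i => ?_⟩
  · rw [sub_nonneg, div_le_one hSpos]
    exact hS1
  · rw [sub_lt_self_iff]
    positivity
  · have hi : kappa a i * v i ≤ S := by
      have := Finset.single_le_sum hnn (Finset.mem_univ i)
      linarith
    simp only [mul_assoc]
    rw [← Finset.mul_sum, heq, inv_mul_le_iff₀ (hκ i)]
    have : kappa a i * v i / S ≤ 1 := (div_le_one hSpos).2 hi
    calc _ ≤ kappa a i * v i - kappa a i * v i / S := by linarith
      _ = _ := by ring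

/-- The containment target of each agent, an equilibrium of the follower averaging. -/
def containmentTarget {N : ℕ} (a : Fin m ⊕ Fin l → Fin m ⊕ Fin l → ℝ)
    (y : Fin l → EuclideanSpace ℝ (Fin N)) : Fin m ⊕ Fin l → EuclideanSpace ℝ (Fin N) :=
  Sum.elim (fun i => ∑ j, (-((lapOne a)⁻¹ * lapTwo a) i j) • y j) y

theorem sum_smul_containmentTarget {N : ℕ} (hann : ∀ k k', 0 ≤ a k k') (hA1 : Assumption1 a)
    (y : Fin l → EuclideanSpace ℝ (Fin N)) (i : Fin m) :
    ∑ k, a (Sum.inl i) k • containmentTarget a y k =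
      kappa a i • containmentTarget a y (Sum.inl i) := by
  set W := (lapOne a)⁻¹ * lapTwo a with hW
  have hLW : lapOne a * W = lapTwo a := by
    rw [hW, ← Matrix.mul_assoc, Matrix.mul_nonsing_inv _ (isUnit_det_lapOne hann hA1),
      Matrix.one_mul]
  have hentry : ∀ j, kappa a i * W i j - ∑ k, a (Sum.inl i) (Sum.inl k) * W k j =
      -a (Sum.inl i) (Sum.inr j) := by
    intro j
    rw [← lapOne_mulVec (a := a) (fun k => W k j) i]
    exact congrFun (congrFun hLW i) j
  simp only [containmentTarget, Fintype.sum_sum_type, Sum.elim_inl, Sum.elim_inr, ← hW,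
    Finset.smul_sum]
  rw [Finset.sum_comm, ← Finset.sum_add_distrib]
  refine Finset.sum_congr rfl fun j _ => ?_
  simp only [smul_smul, ← Finset.sum_smul, ← add_smul]
  congr 1
  have := hentry j
  simp only [mul_neg, Finset.sum_neg_distrib]
  linarith

end Laplacian

/-- Lemma 2, item ii): if in addition the perturbations converge to zero, then
the derivatives of the followers' filter states and position-like states, and
the containment error, all converge to zero as `t → ∞`. -/
theorem stmt4 {m l N : ℕ}
    (a : Fin m ⊕ Fin l → Fin m ⊕ Fin l → ℝ)
    (ha0 : ∀ k, a k k = 0)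
    (hann : ∀ k k', 0 ≤ a k k')
    (haL : ∀ (j : Fin l) (k : Fin m ⊕ Fin l), a (Sum.inr j) k = 0)
    (hA1 : Assumption1 a)
    -- Assumption 2: communication blackouts
    (d : Fin m → Fin m ⊕ Fin l → ℝ → ℝ) (Tstar : ℝ) (hT : 0 < Tstar)
    (hd0 : ∀ i j, 0 < a (Sum.inl i) j → ∀ t, 0 ≤ t → 0 ≤ d i j t ∧ d i j t ≤ t)
    (hdT : ∀ i j, 0 < a (Sum.inl i) j → ∀ t, Tstar ≤ t → t - d i j t ≤ Tstar)
    -- the states, gains, filter orders and perturbations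
    (α : ℝ) (hα : α = 0 ∨ α = 1)
    (η : Fin m ⊕ Fin l → ℝ → EuclideanSpace ℝ (Fin N))
    (kη : Fin m → ℝ) (hkη : ∀ i, 0 < kη i)
    (σ : Fin m → ℕ) (hσ : ∀ i, 0 < σ i)
    (ζ : (i : Fin m) → Fin (σ i) → ℝ → EuclideanSpace ℝ (Fin N))
    (h : (i : Fin m) → Fin (σ i) → ℝ) (hh : ∀ i ℓ, 0 < h i ℓ)
    (Φ1 : Fin m → ℝ → EuclideanSpace ℝ (Fin N))
    (Φ2 : (i : Fin m) → Fin (σ i) → ℝ → EuclideanSpace ℝ (Fin N))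
    (Ψ : Fin l → ℝ → EuclideanSpace ℝ (Fin N))
    -- leaders' dynamics
    (hηL : ∀ (j : Fin l) (t : ℝ), 0 ≤ t → HasDerivAt (η (Sum.inr j)) (Ψ j t) t)
    -- followers' dynamics, with `δ_i = α ζ_{i,1} + (1−α) ε_i`
    (hηF : ∀ (i : Fin m) (t : ℝ), 0 ≤ t →
      HasDerivAt (η (Sum.inl i))
        (-(kη i) • (η (Sum.inl i) t -
            (α • ζ i ⟨0, hσ i⟩ t + (1 - α) • epsAvg a d η i t)) + Φ1 i t) t)
    -- the filter cascade
    (hζ : ∀ (i : Fin m) (ℓ : Fin (σ i)) (t : ℝ), 0 ≤ t →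
      HasDerivAt (ζ i ℓ)
        (-(h i ℓ) • (ζ i ℓ t -
            (if hlt : (ℓ : ℕ) + 1 < σ i then ζ i ⟨(ℓ : ℕ) + 1, hlt⟩ t
              else epsAvg a d η i t)) + Φ2 i ℓ t) t)
    -- uniformly bounded perturbations
    (hΦ1 : ∀ i, ∃ C, ∀ t, 0 ≤ t → ‖Φ1 i t‖ ≤ C)
    (hΦ2 : ∀ i ℓ, ∃ C, ∀ t, 0 ≤ t → ‖Φ2 i ℓ t‖ ≤ C)
    (hΨ : ∀ j, ∃ C, ∀ t, 0 ≤ t → ‖Ψ j t‖ ≤ C)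
    -- vanishing perturbations
    (hΦ1v : ∀ i, Tendsto (Φ1 i) atTop (nhds 0))
    (hΦ2v : ∀ i ℓ, Tendsto (Φ2 i ℓ) atTop (nhds 0))
    (hΨv : ∀ j, Tendsto (Ψ j) atTop (nhds 0)) :
    (∀ (i : Fin m) (ℓ : Fin (σ i)), Tendsto (deriv (ζ i ℓ)) atTop (nhds 0)) ∧
    (∀ i : Fin m, Tendsto (deriv (η (Sum.inl i))) atTop (nhds 0)) ∧
    (∀ i : Fin m, Tendsto (centErr a η i) atTop (nhds 0)) := by
  have hκ := kappa_pos hann hA1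
  have hTnn : ∀ i j, 0 < a (Sum.inl i) j → ∀ t, 0 ≤ t → t - Tstar ≤ d i j t := by
    intro i j hij t ht
    rcases le_total Tstar t with h1 | h1
    · linarith [hdT i j hij t h1]
    · linarith [(hd0 i j hij t ht).1]
  -- the containment target and its derivative
  let c : Fin m ⊕ Fin l → ℝ → EuclideanSpace ℝ (Fin N) :=
    fun k t => containmentTarget a (fun j => η (Sum.inr j) t) k
  let c' : Fin m ⊕ Fin l → ℝ → EuclideanSpace ℝ (Fin N) :=
    fun k t => containmentTarget a (fun j => Ψ j t) k
  have hc : ∀ k t, 0 ≤ t → HasDerivAt (c k) (c' k t) t := by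
    rintro (i | j) t ht
    · have hsum : HasDerivAt (fun t => ∑ j, (-((lapOne a)⁻¹ * lapTwo a) i j) • η (Sum.inr j) t)
          (∑ j, (-((lapOne a)⁻¹ * lapTwo a) i j) • Ψ j t) t :=
        HasDerivAt.fun_sum fun j _ => (hηL j t ht).fun_const_smul _
      exact hsum
    · exact hηL j t ht
  have hc'0 : ∀ k, (∃ C, ∀ t, 0 ≤ t → ‖c' k t‖ ≤ C) ∧ Tendsto (c' k) atTop (nhds 0) := by
    rintro (i | j)
    · exact bounded_vanishing_sum _ hΨ hΨv
    · exact ⟨hΨ j, hΨv j⟩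
  -- residual perturbations in error coordinates
  have hpert : ∀ (i : Fin m) (φ : ℝ → EuclideanSpace ℝ (Fin N)),
      (∃ C, ∀ t, 0 ≤ t → ‖φ t‖ ≤ C) → Tendsto φ atTop (nhds 0) →
      (∃ C, ∀ t, 0 ≤ t → ‖φ t - c' (Sum.inl i) t‖ ≤ C) ∧
        Tendsto (fun t => φ t - c' (Sum.inl i) t) atTop (nhds 0) := by
    rintro i φ ⟨C, hC⟩ hφ
    obtain ⟨⟨C', hC'⟩, h0⟩ := hc'0 (Sum.inl i)
    exact ⟨⟨C + C', fun t ht => norm_sub_le_of_le (hC t ht) (hC' t ht)⟩, by simpa using hφ.sub h0⟩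
  let x : Fin m → ℝ → EuclideanSpace ℝ (Fin N) := fun i t => η (Sum.inl i) t - c (Sum.inl i) t
  let z : (i : Fin m) → Fin (σ i) → ℝ → EuclideanSpace ℝ (Fin N) :=
    fun i ℓ t => ζ i ℓ t - c (Sum.inl i) t
  let e : Fin m → ℝ → EuclideanSpace ℝ (Fin N) := fun i t => epsAvg a d η i t - c (Sum.inl i) t
  have hcascade : ∀ i, ∀ n : ℕ, ∀ ℓ : Fin (σ i), (ℓ : ℕ) + 1 + n = σ i →
      HasUnitGain (e i) (z i ℓ) := by
    intro i n
    induction n with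
    | zero =>
      intro ℓ hℓ
      obtain ⟨hb, h0⟩ := hpert i _ (hΦ2 i ℓ) (hΦ2v i ℓ)
      refine HasUnitGain.of_first_order_lag (hh i ℓ) (fun t ht => ?_) hb h0
      refine ((hζ i ℓ t ht).sub (hc (Sum.inl i) t ht)).congr_deriv ?_
      rw [dif_neg (by omega)]
      simp only [z, e]
      module
    | succ n ih =>
      intro ℓ hℓ
      have hlt : (ℓ : ℕ) + 1 < σ i := by omega
      obtain ⟨hb, h0⟩ := hpert i _ (hΦ2 i ℓ) (hΦ2v i ℓ)
      refine (ih ⟨(ℓ : ℕ) + 1, hlt⟩ (by simp only; omega)).trans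
        (HasUnitGain.of_first_order_lag (hh i ℓ) (fun t ht => ?_) hb h0)
      refine ((hζ i ℓ t ht).sub (hc (Sum.inl i) t ht)).congr_deriv ?_
      rw [dif_pos hlt]
      simp only [z]
      module
  have hz : ∀ i ℓ, HasUnitGain (e i) (z i ℓ) := fun i ℓ =>
    hcascade i (σ i - (ℓ + 1)) ℓ (by have := ℓ.2; omega)
  have hxgain : ∀ i, HasUnitGain (e i) (x i) := by
    intro i
    obtain ⟨hb, h0⟩ := hpert i _ (hΦ1 i) (hΦ1v i)
    rcases hα with rfl | rfl
    · refine HasUnitGain.of_first_order_lag (hkη i) (fun t ht => ?_) hb h0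
      refine ((hηF i t ht).sub (hc (Sum.inl i) t ht)).congr_deriv ?_
      simp only [x, e]
      module
    · refine (hz i ⟨0, hσ i⟩).trans
        (HasUnitGain.of_first_order_lag (hkη i) (fun t ht => ?_) hb h0)
      refine ((hηF i t ht).sub (hc (Sum.inl i) t ht)).congr_deriv ?_
      simp only [x, z]
      module
  -- the effect of the delays on the containment target
  let q : Fin m → Fin m ⊕ Fin l → ℝ → EuclideanSpace ℝ (Fin N) :=
    fun i k t => if 0 < a (Sum.inl i) k then c k (d i k t) - c k t else 0
  have hq : ∀ i k, (∃ C, ∀ t, 0 ≤ t → ‖q i k t‖ ≤ C) ∧ Tendsto (q i k) atTop (nhds 0) := by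
    intro i k
    by_cases hik : 0 < a (Sum.inl i) k
    · simp only [q, if_pos hik]
      exact slow_variation hT.le (hc k) (hc'0 k).1 (hc'0 k).2 (hd0 i k hik) (hTnn i k hik)
    · simp only [q, if_neg hik]
      exact ⟨⟨0, fun t _ => by simp⟩, tendsto_const_nhds⟩
  have hr := fun i => bounded_vanishing_sum (fun k => (kappa a i)⁻¹ * a (Sum.inl i) k)
    (fun k => (hq i k).1) (fun k => (hq i k).2)
  have he : ∀ i t, e i t =
      ∑ j, ((kappa a i)⁻¹ * a (Sum.inl i) (Sum.inl j)) • x j (d i (Sum.inl j) t) +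
        ∑ k, ((kappa a i)⁻¹ * a (Sum.inl i) k) • q i k t := by
    intro i t
    have hq' : ∀ k, ((kappa a i)⁻¹ * a (Sum.inl i) k) • q i k t =
        (kappa a i)⁻¹ • (a (Sum.inl i) k • c k (d i k t) - a (Sum.inl i) k • c k t) := by
      intro k
      by_cases hik : 0 < a (Sum.inl i) k
      · simp only [q, if_pos hik]
        module
      · have h0 : a (Sum.inl i) k = 0 := le_antisymm (not_lt.1 hik) (hann _ _)
        simp [h0]
    have htarget : (kappa a i)⁻¹ • ∑ k, a (Sum.inl i) k • c k t = c (Sum.inl i) t := by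
      simp only [c]
      rw [sum_smul_containmentTarget hann hA1, inv_smul_smul₀ (hκ i).ne']
    have hx' : ∑ j, ((kappa a i)⁻¹ * a (Sum.inl i) (Sum.inl j)) • x j (d i (Sum.inl j) t) =
        (kappa a i)⁻¹ • ∑ k, a (Sum.inl i) k • (η k (d i k t) - c k (d i k t)) := by
      rw [Fintype.sum_sum_type, smul_add, Finset.smul_sum, Finset.smul_sum]
      simp only [x, c, containmentTarget, Sum.elim_inr, sub_self, smul_zero,
        Finset.sum_const_zero, add_zero, smul_smul]
    simp only [hq', hx', ← Finset.smul_sum, Finset.sum_sub_distrib, smul_sub, htarget, e, epsAvg]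
    abel
  obtain ⟨v, ρ, hv, hρ0, hρ1, hwv⟩ := exists_contraction_weight hann hA1
  have hwpos : ∀ i j, 0 < (kappa a i)⁻¹ * a (Sum.inl i) (Sum.inl j) →
      0 < a (Sum.inl i) (Sum.inl j) := fun i j hij =>
    pos_of_mul_pos_right hij (inv_nonneg.2 (hκ i).le)
  have hw : ∀ i j, 0 ≤ (kappa a i)⁻¹ * a (Sum.inl i) (Sum.inl j) := fun i j =>
    mul_nonneg (inv_nonneg.2 (hκ i).le) (hann _ _)
  have hx0 : ∀ i, Tendsto (x i) atTop (nhds 0) :=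
    tendsto_zero_of_delayed_contraction (d := fun i j => d i (Sum.inl j)) hxgain
      (fun i t ht => ((hηF i t ht).sub (hc (Sum.inl i) t ht)).continuousAt.continuousWithinAt)
      (fun i t _ => by
        rw [he]
        refine (norm_add_le _ _).trans (add_le_add_left (norm_sum_le_of_le _ fun j _ => ?_) _)
        rw [norm_smul, Real.norm_of_nonneg (hw i j)])
      (fun i => (hr i).1) (fun i => (hr i).2) hw
      (fun i j hij => hd0 i _ (hwpos i j hij)) (fun i j hij => hTnn i _ (hwpos i j hij))
      hv hρ0 hρ1 hwv
  have he0 : ∀ i, Tendsto (e i) atTop (nhds 0) := by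
    intro i
    have hsum : Tendsto (fun t => ∑ j, ((kappa a i)⁻¹ * a (Sum.inl i) (Sum.inl j)) •
        x j (d i (Sum.inl j) t)) atTop (nhds 0) := by
      rw [← Finset.sum_const_zero (s := Finset.univ (α := Fin m))]
      refine tendsto_finsetSum _ fun j _ => ?_
      rcases (hann (Sum.inl i) (Sum.inl j)).eq_or_lt with h0 | h0
      · simp [← h0]
      · have hd : Tendsto (d i (Sum.inl j)) atTop atTop :=
          tendsto_atTop_mono' _
            ((eventually_ge_atTop 0).mono fun t ht => hTnn i _ h0 t ht)
            (tendsto_atTop_add_const_right _ (-Tstar) tendsto_id)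
        simpa using ((hx0 j).comp hd).const_smul ((kappa a i)⁻¹ * a (Sum.inl i) (Sum.inl j))
    rw [funext (he i)]
    simpa using hsum.add (hr i).2
  have hz0 : ∀ i ℓ, Tendsto (z i ℓ) atTop (nhds 0) := fun i ℓ =>
    ((hz i ℓ).limit 0 le_rfl (eventuallyNormLe_zero_of_tendsto (he0 i))).tendsto_zero
  refine ⟨fun i ℓ => ?_, fun i => ?_, fun i => ?_⟩
  · have hlim : Tendsto (fun t => -(h i ℓ) • (z i ℓ t -
        (if hlt : (ℓ : ℕ) + 1 < σ i then z i ⟨(ℓ : ℕ) + 1, hlt⟩ t else e i t)) + Φ2 i ℓ t)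
        atTop (nhds 0) := by
      split_ifs with hlt
      · simpa using (((hz0 i ℓ).sub (hz0 i ⟨_, hlt⟩)).const_smul (-(h i ℓ))).add (hΦ2v i ℓ)
      · simpa using (((hz0 i ℓ).sub (he0 i)).const_smul (-(h i ℓ))).add (hΦ2v i ℓ)
    refine hlim.congr' ?_
    filter_upwards [eventually_ge_atTop 0] with t ht
    rw [(hζ i ℓ t ht).deriv]
    split_ifs <;> simp only [z, e, sub_sub_sub_cancel_right]
  · have hlim : Tendsto (fun t => -(kη i) • (x i t -
        (α • z i ⟨0, hσ i⟩ t + (1 - α) • e i t)) + Φ1 i t) atTop (nhds 0) := by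
      simpa using (((hx0 i).sub (((hz0 i ⟨0, hσ i⟩).const_smul α).add
        ((he0 i).const_smul (1 - α)))).const_smul (-(kη i))).add (hΦ1v i)
    refine hlim.congr' ?_
    filter_upwards [eventually_ge_atTop 0] with t ht
    rw [(hηF i t ht).deriv]
    simp only [x, z, e]
    module
  · refine (hx0 i).congr fun t => ?_
    simp only [x, c, containmentTarget, centErr, Sum.elim_inl, neg_smul,
      Finset.sum_neg_distrib, sub_neg_eq_add]
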